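/- arXiv:1211.3634 — 9 statements merged into one kernel-verified Lean document; each statement's English description precedes it below -/
import Mathlib

section
/- Let u ∈ D(G). Then u ∈ BD(G) (i.e., u is orthogonal to D(G̊) in D(G) with respect to the graph inner product) if and only if Gu ∈ D(D) and DGu = u. In other words, BD(G) equals the kernel of 1 − DG, i.e. BD(G) = {u ∈ D(G) : Gu ∈ D(D), DGu = u}. -/
open scoped InnerProductSpace

theorem LinearPMap.exists_neg_adjoint_apply_eq_iff {𝕜 E F : Type*} [RCLike 𝕜]
    [NormedAddCommGroup E] [InnerProductSpace 𝕜 E] [CompleteSpace E]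
    [NormedAddCommGroup F] [InnerProductSpace 𝕜 F]
    {T : E →ₗ.[𝕜] F} (hT : Dense (T.domain : Set E)) (x : E) (y : F) :
    (∃ h : y ∈ (-T.adjoint).domain, (-T.adjoint) ⟨y, h⟩ = x) ↔
      ∀ w : T.domain, inner 𝕜 (w : E) x + inner 𝕜 (T w) y = 0 := by
  constructor
  · rintro ⟨h, rfl⟩ w
    have h' : y ∈ T.adjoint.domain := h
    have key := (adjoint_isFormalAdjoint hT).symm w ⟨y, h'⟩
    rw [LinearPMap.neg_apply, inner_neg_right]
    exact neg_add_eq_zero.2 key.symm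
  · intro hx
    have hxy (w : T.domain) : inner 𝕜 (-x) (w : E) = inner 𝕜 y (T w) := by
      rw [← inner_conj_symm, ← inner_conj_symm y, inner_neg_right,
        neg_eq_of_add_eq_zero_right (hx w)]
    have hy : y ∈ T.adjoint.domain := mem_adjoint_domain_of_exists y ⟨-x, hxy⟩
    refine ⟨hy, ?_⟩
    rw [LinearPMap.neg_apply, neg_eq_iff_eq_neg]
    exact adjoint_apply_eq hT ⟨y, hy⟩ hxy

theorem stmt_0 {H₀ H₁ : Type*}
    [NormedAddCommGroup H₀] [InnerProductSpace ℂ H₀] [CompleteSpace H₀]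
    [NormedAddCommGroup H₁] [InnerProductSpace ℂ H₁] [CompleteSpace H₁]
    (G₀ : H₀ →ₗ.[ℂ] H₁) (D₀ : H₁ →ₗ.[ℂ] H₀)
    (hG₀dense : Dense (G₀.domain : Set H₀)) (hD₀dense : Dense (D₀.domain : Set H₁))
    (hG₀closed : G₀.IsClosed) (hD₀closed : D₀.IsClosed)
    (hskew : ∀ (u : G₀.domain) (v : D₀.domain),
      ⟪G₀ u, (v : H₁)⟫_ℂ = - ⟪(u : H₀), D₀ v⟫_ℂ)
    (G : H₀ →ₗ.[ℂ] H₁) (D : H₁ →ₗ.[ℂ] H₀)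
    (hG : G = - D₀.adjoint) (hD : D = - G₀.adjoint)
    (u : G.domain) :
    (∀ w : G₀.domain, ⟪(w : H₀), (u : H₀)⟫_ℂ + ⟪G₀ w, G u⟫_ℂ = 0)
      ↔ ∃ h : G u ∈ D.domain, D ⟨G u, h⟩ = (u : H₀) := by
  subst hD
  exact (LinearPMap.exists_neg_adjoint_apply_eq_iff hG₀dense (u : H₀) (G u)).symm
end

section
/- For every u ∈ BD(G), the functional Φ_u : D(D) → ℂ, Φ_u(v) := ⟨Gu, v⟩_{H₁} + ⟨u, Dv⟩_{H₀}, is bounded with respect to the graph norm of D, and its operator norm equals the graph norm of u; that is, sup{ |⟨Gu, v⟩_{H₁} + ⟨u, Dv⟩_{H₀}| : v ∈ D(D), ‖v‖²_{H₁} + ‖Dv‖²_{H₀} ≤ 1 } = (‖u‖²_{H₀} + ‖Gu‖²_{H₁})^{1/2}. (This expresses that the abstract trace γ_G := G − G̊ restricted to BD(G) is an isometry from BD(G) into the dual H₋₁(|D|+i) of the graph space of D.) -/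
open scoped InnerProductSpace

open ComplexConjugate

/-- If `⟪w, u⟫ + ⟪T w, y⟫ = 0` for all `w` in the domain of `T`, then `y` lies in the domain of
`-T†` and is mapped to `u`. -/
lemma exists_neg_adjoint_apply_eq {E F : Type*}
    [NormedAddCommGroup E] [InnerProductSpace ℂ E] [CompleteSpace E]
    [NormedAddCommGroup F] [InnerProductSpace ℂ F]
    {T : E →ₗ.[ℂ] F} (hT : Dense (T.domain : Set E)) {u : E} {y : F}
    (h : ∀ w : T.domain, ⟪(w : E), u⟫_ℂ + ⟪T w, y⟫_ℂ = 0) :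
    ∃ v : (-T.adjoint).domain, (v : F) = y ∧ (-T.adjoint) v = u := by
  have key (x : T.domain) : ⟪-u, (x : E)⟫_ℂ = ⟪y, T x⟫_ℂ := by
    have hx := congrArg conj (h x)
    simp only [map_add, inner_conj_symm, map_zero] at hx
    rw [inner_neg_left]
    linear_combination -hx
  have hy : y ∈ T.adjoint.domain := LinearPMap.mem_adjoint_domain_of_exists y ⟨-u, key⟩
  refine ⟨⟨y, hy⟩, rfl, ?_⟩
  rw [LinearPMap.neg_apply, LinearPMap.adjoint_apply_eq hT ⟨y, hy⟩ key, neg_neg]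

/-- The Cauchy–Schwarz inequality for the sum of two inner products. -/
lemma norm_inner_add_inner_le {E F : Type*}
    [NormedAddCommGroup E] [InnerProductSpace ℂ E] [NormedAddCommGroup F] [InnerProductSpace ℂ F]
    (x x' : E) (y y' : F) :
    ‖⟪y, y'⟫_ℂ + ⟪x, x'⟫_ℂ‖ ≤ √(‖x‖ ^ 2 + ‖y‖ ^ 2) * √(‖y'‖ ^ 2 + ‖x'‖ ^ 2) := by
  refine (norm_add_le_of_le (norm_inner_le_norm y y') (norm_inner_le_norm x x')).trans ?_
  rw [← Real.sqrt_mul (by positivity)]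
  refine Real.le_sqrt_of_sq_le ?_
  nlinarith [sq_nonneg (‖y‖ * ‖x'‖ - ‖x‖ * ‖y'‖)]

theorem stmt_3 {H₀ H₁ : Type*}
    [NormedAddCommGroup H₀] [InnerProductSpace ℂ H₀] [CompleteSpace H₀]
    [NormedAddCommGroup H₁] [InnerProductSpace ℂ H₁] [CompleteSpace H₁]
    (G₀ : H₀ →ₗ.[ℂ] H₁) (D₀ : H₁ →ₗ.[ℂ] H₀)
    (hG₀dense : Dense (G₀.domain : Set H₀)) (hD₀dense : Dense (D₀.domain : Set H₁))
    (hG₀closed : G₀.IsClosed) (hD₀closed : D₀.IsClosed)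
    (hskew : ∀ (u : G₀.domain) (v : D₀.domain),
      ⟪G₀ u, (v : H₁)⟫_ℂ = - ⟪(u : H₀), D₀ v⟫_ℂ)
    (G : H₀ →ₗ.[ℂ] H₁) (D : H₁ →ₗ.[ℂ] H₀)
    (hG : G = - D₀.adjoint) (hD : D = - G₀.adjoint)
    (u : G.domain)
    (hu : ∀ w : G₀.domain, ⟪(w : H₀), (u : H₀)⟫_ℂ + ⟪G₀ w, G u⟫_ℂ = 0) :
    -- the functional `Φ_u : v ↦ ⟪Gu, v⟫ + ⟪u, Dv⟫` is bounded w.r.t. the graph norm of `D` ...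
    (∀ v : D.domain, ‖⟪G u, (v : H₁)⟫_ℂ + ⟪(u : H₀), D v⟫_ℂ‖
        ≤ Real.sqrt (‖(u : H₀)‖ ^ 2 + ‖G u‖ ^ 2) * Real.sqrt (‖(v : H₁)‖ ^ 2 + ‖D v‖ ^ 2)) ∧
    -- ... and its operator norm equals the graph norm of `u`:
    sSup {r : ℝ | ∃ v : D.domain, ‖(v : H₁)‖ ^ 2 + ‖D v‖ ^ 2 ≤ 1 ∧
        r = ‖⟪G u, (v : H₁)⟫_ℂ + ⟪(u : H₀), D v⟫_ℂ‖}
      = Real.sqrt (‖(u : H₀)‖ ^ 2 + ‖G u‖ ^ 2) := by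
  have bound (v : D.domain) := norm_inner_add_inner_le (u : H₀) (D v) (G u) (v : H₁)
  refine ⟨bound, IsGreatest.csSup_eq ⟨?_, ?_⟩⟩
  · obtain ⟨v, hv, hDv⟩ : ∃ v : D.domain, (v : H₁) = G u ∧ D v = u := by
      subst hD
      exact exists_neg_adjoint_apply_eq hG₀dense hu
    set N := √(‖(u : H₀)‖ ^ 2 + ‖G u‖ ^ 2) with hN
    have hN0 : 0 ≤ N := Real.sqrt_nonneg _
    have hNsq : N ^ 2 = ‖(u : H₀)‖ ^ 2 + ‖G u‖ ^ 2 := Real.sq_sqrt (by positivity)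
    refine ⟨((N⁻¹ : ℝ) : ℂ) • v, ?_, ?_⟩
    · rw [LinearPMap.map_smul, Submodule.coe_smul, hv, hDv, norm_smul, norm_smul,
        Complex.norm_real, Real.norm_of_nonneg (inv_nonneg.2 hN0)]
      calc (N⁻¹ * ‖G u‖) ^ 2 + (N⁻¹ * ‖(u : H₀)‖) ^ 2 = (N⁻¹ * N) ^ 2 := by
            rw [mul_pow N⁻¹ N, hNsq]; ring
        _ ≤ 1 := pow_le_one₀ (by positivity) inv_mul_le_one
    · rw [LinearPMap.map_smul, Submodule.coe_smul, hv, hDv, inner_smul_right, inner_smul_right,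
        inner_self_eq_norm_sq_to_K, inner_self_eq_norm_sq_to_K]
      have : ((N⁻¹ : ℝ) : ℂ) * (‖G u‖ : ℂ) ^ 2 + ((N⁻¹ : ℝ) : ℂ) * (‖(u : H₀)‖ : ℂ) ^ 2
          = ((N⁻¹ * N ^ 2 : ℝ) : ℂ) := by
        rw [hNsq]; push_cast; ring
      erw [this]
      rw [Complex.norm_real, Real.norm_of_nonneg (by positivity)]
      rcases eq_or_ne N 0 with h | h
      · simp [h]
      · field_simp
  · rintro _ ⟨v, hv, rfl⟩
    exact (bound v).trans (mul_le_of_le_one_right (Real.sqrt_nonneg _) (Real.sqrt_le_one.2 hv))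
end

section
/- For every u ∈ D(G) there exists a unique w ∈ BD(G) with the same abstract trace as u, i.e. such that ⟨Gu, v⟩_{H₁} + ⟨u, Dv⟩_{H₀} = ⟨Gw, v⟩_{H₁} + ⟨w, Dv⟩_{H₀} for all v ∈ D(D). (This expresses that the restriction of the abstract trace γ_G := G − G̊ to BD(G) is onto the trace space TR(G) = γ_G[D(G)].) -/
open scoped InnerProductSpace

namespace LinearPMap

variable {E F : Type*} [NormedAddCommGroup E] [InnerProductSpace ℂ E]
  [NormedAddCommGroup F] [InnerProductSpace ℂ F]

/-- An element admitting a formal skew-adjoint value `x` lies in the domain of `-T†`, and `-T†`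
takes the value `x` there. -/
theorem exists_neg_adjoint_apply_eq [CompleteSpace E] {T : E →ₗ.[ℂ] F}
    (hT : Dense (T.domain : Set E)) {y : F} {x : E}
    (h : ∀ z : T.domain, ⟪x, (z : E)⟫_ℂ = -⟪y, T z⟫_ℂ) :
    ∃ y' : (-T.adjoint).domain, (y' : F) = y ∧ (-T.adjoint) y' = x := by
  have h' : ∀ z : T.domain, ⟪-x, (z : E)⟫_ℂ = ⟪y, T z⟫_ℂ := fun z => by
    rw [inner_neg_left, h, neg_neg]
  have hy : y ∈ T.adjoint.domain := mem_adjoint_domain_of_exists y ⟨-x, h'⟩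
  refine ⟨⟨y, hy⟩, rfl, ?_⟩
  have : T.adjoint ⟨y, hy⟩ = -x := adjoint_apply_eq hT _ h'
  rw [neg_apply]
  exact neg_eq_iff_eq_neg.mpr this

/-- `T` and `-T†` are formally skew-adjoint. -/
theorem inner_neg_adjoint [CompleteSpace E] {T : E →ₗ.[ℂ] F} (hT : Dense (T.domain : Set E))
    (z : T.domain) (y : (-T.adjoint).domain) :
    ⟪T z, (y : F)⟫_ℂ + ⟪(z : E), (-T.adjoint) y⟫_ℂ = 0 := by
  have h : ⟪T z, (y : F)⟫_ℂ = ⟪(z : E), T.adjoint y⟫_ℂ :=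
    (adjoint_isFormalAdjoint hT).symm z y
  rw [neg_apply, inner_neg_right, h, add_neg_cancel]

/-- Orthogonal decomposition of a pair along the graph of a closed operator. -/
theorem IsClosed.exists_inner_sub_eq_zero [CompleteSpace E] [CompleteSpace F] {T : E →ₗ.[ℂ] F}
    (hT : T.IsClosed) (x : E) (y : F) :
    ∃ z : T.domain, ∀ v : T.domain, ⟪(v : E), x - z⟫_ℂ + ⟪T v, y - T z⟫_ℂ = 0 := by
  let e := WithLp.prodContinuousLinearEquiv 2 ℂ E F
  let K : Submodule ℂ (WithLp 2 (E × F)) := T.graph.comap e.toLinearEquiv.toLinearMap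
  have hK : _root_.IsClosed (K : Set (WithLp 2 (E × F))) := hT.preimage e.continuous
  have : CompleteSpace K := hK.completeSpace_coe
  let p := K.starProjection (WithLp.toLp 2 (x, y))
  have hp : p ∈ K := K.starProjection_apply_mem _
  obtain ⟨z, hz₁, hz₂⟩ := (mem_graph_iff T).mp (show e p ∈ T.graph from hp)
  refine ⟨z, fun v => ?_⟩
  have hv : WithLp.toLp 2 ((v : E), T v) ∈ K := T.mem_graph v
  have h := K.starProjection_inner_eq_zero (WithLp.toLp 2 (x, y)) _ hv
  rw [← inner_conj_symm, map_eq_zero, WithLp.prod_inner_apply] at h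
  rw [hz₁, hz₂]
  exact h

end LinearPMap

theorem stmt_4 {H₀ H₁ : Type*}
    [NormedAddCommGroup H₀] [InnerProductSpace ℂ H₀] [CompleteSpace H₀]
    [NormedAddCommGroup H₁] [InnerProductSpace ℂ H₁] [CompleteSpace H₁]
    (G₀ : H₀ →ₗ.[ℂ] H₁) (D₀ : H₁ →ₗ.[ℂ] H₀)
    (hG₀dense : Dense (G₀.domain : Set H₀)) (hD₀dense : Dense (D₀.domain : Set H₁))
    (hG₀closed : G₀.IsClosed) (hD₀closed : D₀.IsClosed)
    (hskew : ∀ (u : G₀.domain) (v : D₀.domain),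
      ⟪G₀ u, (v : H₁)⟫_ℂ = - ⟪(u : H₀), D₀ v⟫_ℂ)
    (G : H₀ →ₗ.[ℂ] H₁) (D : H₁ →ₗ.[ℂ] H₀)
    (hG : G = - D₀.adjoint) (hD : D = - G₀.adjoint)
    (u : G.domain) :
    ∃! w : G.domain,
      (∀ v : G₀.domain, ⟪(v : H₀), (w : H₀)⟫_ℂ + ⟪G₀ v, G w⟫_ℂ = 0) ∧
      ∀ v : D.domain,
        ⟪G u, (v : H₁)⟫_ℂ + ⟪(u : H₀), D v⟫_ℂ = ⟪G w, (v : H₁)⟫_ℂ + ⟪(w : H₀), D v⟫_ℂ := by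
  have hG₀G (z : G₀.domain) : ∃ y : G.domain, (y : H₀) = z ∧ G y = G₀ z := by
    subst hG
    exact LinearPMap.exists_neg_adjoint_apply_eq hD₀dense fun v => hskew z v
  have hG₀D (z : G₀.domain) (v : D.domain) : ⟪G₀ z, (v : H₁)⟫_ℂ + ⟪(z : H₀), D v⟫_ℂ = 0 := by
    subst hD
    exact LinearPMap.inner_neg_adjoint hG₀dense z v
  obtain ⟨z, hz⟩ := hG₀closed.exists_inner_sub_eq_zero (u : H₀) (G u)
  obtain ⟨y, hyz, hGy⟩ := hG₀G z
  refine ⟨u - y, ⟨fun v => ?_, fun v => ?_⟩, fun w hw => ?_⟩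
  · simpa [LinearPMap.map_sub, hyz, hGy] using hz v
  · have := hG₀D z v
    simp only [LinearPMap.map_sub, AddSubgroupClass.coe_sub, hyz, hGy, inner_sub_left]
    linear_combination this
  · obtain ⟨hw₁, hw₂⟩ := hw
    set d : G.domain := w - (u - y) with hd
    have hd_orth (v : G₀.domain) : ⟪(v : H₀), (d : H₀)⟫_ℂ + ⟪G₀ v, G d⟫_ℂ = 0 := by
      have h₁ := hw₁ v
      have h₂ := hz v
      simp only [hd, LinearPMap.map_sub, AddSubgroupClass.coe_sub, hyz, hGy, inner_sub_right]
        at h₁ h₂ ⊢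
      linear_combination h₁ - h₂
    have hd_trace (v : D.domain) : ⟪G d, (v : H₁)⟫_ℂ + ⟪(d : H₀), D v⟫_ℂ = 0 := by
      have h₁ := hw₂ v
      have h₂ := hG₀D z v
      simp only [hd, LinearPMap.map_sub, AddSubgroupClass.coe_sub, hyz, hGy, inner_sub_left]
      linear_combination -h₁ + h₂
    obtain ⟨v, hv, hDv⟩ : ∃ v : D.domain, (v : H₁) = G d ∧ D v = d := by
      subst hD
      refine LinearPMap.exists_neg_adjoint_apply_eq hG₀dense fun v => ?_
      have h := congrArg (starRingEnd ℂ) (hd_orth v)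
      rw [map_add, inner_conj_symm, inner_conj_symm, map_zero] at h
      exact eq_neg_of_add_eq_zero_left h
    have h := congrArg Complex.re (hd_trace v)
    rw [hv, hDv, Complex.add_re, Complex.zero_re] at h
    have hGd_nonneg : 0 ≤ (⟪G d, G d⟫_ℂ).re := inner_self_nonneg (𝕜 := ℂ)
    have hd_norm : (⟪(d : H₀), (d : H₀)⟫_ℂ).re = ‖(d : H₀)‖ ^ 2 :=
      (norm_sq_eq_re_inner (𝕜 := ℂ) (d : H₀)).symm
    have hd0 : (d : H₀) = 0 := by
      rw [← norm_eq_zero, ← sq_eq_zero_iff]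
      exact le_antisymm (by linarith) (sq_nonneg _)
    exact sub_eq_zero.mp (Subtype.ext hd0)
end

section
/- If u ∈ BD(G) then Gu ∈ BD(D), and if ζ ∈ BD(D) then Dζ ∈ BD(G). The restricted maps Ġ : BD(G) → BD(D), u ↦ Gu, and Ḋ : BD(D) → BD(G), ζ ↦ Dζ, are mutually inverse bijections, and Ġ is unitary with respect to the graph inner products: for all u, w ∈ BD(G), ⟨Gu, Gw⟩_{H₁} + ⟨D(Gu), D(Gw)⟩_{H₀} = ⟨u, w⟩_{H₀} + ⟨Gu, Gw⟩_{H₁}. In particular (Ġ)* = Ḋ = (Ġ)⁻¹, so both Ġ and Ḋ are unitary. -/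
open scoped InnerProductSpace

/-- The boundary data space `BD(G)`: the orthogonal complement of `D(G̊)` in the graph space
`D(G)` with respect to the graph inner product. -/
def boundaryData {E F : Type*}
    [NormedAddCommGroup E] [InnerProductSpace ℂ E]
    [NormedAddCommGroup F] [InnerProductSpace ℂ F]
    (G₀ G : E →ₗ.[ℂ] F) : Set G.domain :=
  {u | ∀ w : G₀.domain, ⟪(w : E), (u : E)⟫_ℂ + ⟪G₀ w, G u⟫_ℂ = 0}

/-- The maximal operator `-S†` and the minimal operator `S` satisfy integration by parts. -/
theorem inner_neg_adjoint_right {E F : Type*}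
    [NormedAddCommGroup E] [InnerProductSpace ℂ E]
    [NormedAddCommGroup F] [InnerProductSpace ℂ F] [CompleteSpace F]
    {S : F →ₗ.[ℂ] E} (hS : Dense (S.domain : Set F)) {T : E →ₗ.[ℂ] F} (hT : T = -S.adjoint)
    (v : S.domain) (u : T.domain) :
    ⟪(v : F), T u⟫_ℂ + ⟪S v, (u : E)⟫_ℂ = 0 := by
  subst hT
  have h := (LinearPMap.adjoint_isFormalAdjoint hS).symm v u
  rw [LinearPMap.neg_apply, inner_neg_right, ← h, neg_add_cancel]

/-- The maximal operator `G` maps `BD(G)` into `BD(D)`, where it is inverted by `D`. -/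
theorem exists_mem_boundaryData {E F : Type*}
    [NormedAddCommGroup E] [InnerProductSpace ℂ E] [CompleteSpace E]
    [NormedAddCommGroup F] [InnerProductSpace ℂ F] [CompleteSpace F]
    {G₀ G : E →ₗ.[ℂ] F} {D₀ D : F →ₗ.[ℂ] E}
    (hG₀ : Dense (G₀.domain : Set E)) (hD₀ : Dense (D₀.domain : Set F))
    (hG : G = -D₀.adjoint) (hD : D = -G₀.adjoint)
    {u : G.domain} (hu : u ∈ boundaryData G₀ G) :
    ∃ h : G u ∈ D.domain, (⟨G u, h⟩ : D.domain) ∈ boundaryData D₀ D ∧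
      D ⟨G u, h⟩ = (u : E) := by
  have key (x : G₀.domain) : ⟪-(u : E), (x : E)⟫_ℂ = ⟪G u, G₀ x⟫_ℂ := by
    rw [← inner_conj_symm, ← inner_conj_symm (G u), inner_neg_right,
      neg_eq_of_add_eq_zero_right (hu x)]
  have h : G u ∈ D.domain := by
    rw [hD]
    exact LinearPMap.mem_adjoint_domain_of_exists _ ⟨_, key⟩
  have hDG : D ⟨G u, h⟩ = (u : E) := by
    clear hG
    subst hD
    rw [LinearPMap.neg_apply, neg_eq_iff_eq_neg]
    exact LinearPMap.adjoint_apply_eq hG₀ _ key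
  refine ⟨h, fun v => ?_, hDG⟩
  rw [hDG]
  exact inner_neg_adjoint_right hD₀ hG v u

theorem stmt_6 {H₀ H₁ : Type*}
    [NormedAddCommGroup H₀] [InnerProductSpace ℂ H₀] [CompleteSpace H₀]
    [NormedAddCommGroup H₁] [InnerProductSpace ℂ H₁] [CompleteSpace H₁]
    (G₀ : H₀ →ₗ.[ℂ] H₁) (D₀ : H₁ →ₗ.[ℂ] H₀)
    (hG₀dense : Dense (G₀.domain : Set H₀)) (hD₀dense : Dense (D₀.domain : Set H₁))
    (hG₀closed : G₀.IsClosed) (hD₀closed : D₀.IsClosed)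
    (hskew : ∀ (u : G₀.domain) (v : D₀.domain),
      ⟪G₀ u, (v : H₁)⟫_ℂ = - ⟪(u : H₀), D₀ v⟫_ℂ)
    (G : H₀ →ₗ.[ℂ] H₁) (D : H₁ →ₗ.[ℂ] H₀)
    (hG : G = - D₀.adjoint) (hD : D = - G₀.adjoint) :
    -- `Ġ` maps `BD(G)` into `BD(D)` and `Ḋ ∘ Ġ = id`:
    (∀ u : G.domain, u ∈ boundaryData G₀ G →
      ∃ h : G u ∈ D.domain, (⟨G u, h⟩ : D.domain) ∈ boundaryData D₀ D ∧
        D ⟨G u, h⟩ = (u : H₀)) ∧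
    -- `Ḋ` maps `BD(D)` into `BD(G)` and `Ġ ∘ Ḋ = id`:
    (∀ ζ : D.domain, ζ ∈ boundaryData D₀ D →
      ∃ h : D ζ ∈ G.domain, (⟨D ζ, h⟩ : G.domain) ∈ boundaryData G₀ G ∧
        G ⟨D ζ, h⟩ = (ζ : H₁)) ∧
    -- `Ġ` preserves the graph inner products (it is unitary):
    (∀ u w : G.domain, u ∈ boundaryData G₀ G → w ∈ boundaryData G₀ G →
      ∀ (hu : G u ∈ D.domain) (hw : G w ∈ D.domain),
        ⟪G u, G w⟫_ℂ + ⟪D ⟨G u, hu⟩, D ⟨G w, hw⟩⟫_ℂ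
          = ⟪(u : H₀), (w : H₀)⟫_ℂ + ⟪G u, G w⟫_ℂ) ∧
    -- `(Ġ)* = Ḋ`:
    (∀ (u : G.domain) (ζ : D.domain), u ∈ boundaryData G₀ G → ζ ∈ boundaryData D₀ D →
      ∀ (hu : G u ∈ D.domain) (hζ : D ζ ∈ G.domain),
        ⟪G u, (ζ : H₁)⟫_ℂ + ⟪D ⟨G u, hu⟩, D ζ⟫_ℂ
          = ⟪(u : H₀), D ζ⟫_ℂ + ⟪G u, G ⟨D ζ, hζ⟩⟫_ℂ) := by
  refine ⟨fun u hu => exists_mem_boundaryData hG₀dense hD₀dense hG hD hu,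
    fun ζ hζ => exists_mem_boundaryData hD₀dense hG₀dense hD hG hζ, ?_, ?_⟩
  · intro u w hu hw _ _
    obtain ⟨_, _, hDu⟩ := exists_mem_boundaryData hG₀dense hD₀dense hG hD hu
    obtain ⟨_, _, hDw⟩ := exists_mem_boundaryData hG₀dense hD₀dense hG hD hw
    rw [hDu, hDw, add_comm]
  · intro u ζ hu hζ _ _
    obtain ⟨_, _, hDu⟩ := exists_mem_boundaryData hG₀dense hD₀dense hG hD hu
    obtain ⟨_, _, hGζ⟩ := exists_mem_boundaryData hD₀dense hG₀dense hD hG hζ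
    rw [hDu, hGζ, add_comm]
end

section
/- Let z ∈ ℂ \ {0}, let c₀, c₁ > 0, and suppose Re⟨z⁻¹ K p, p⟩ ≥ c₀‖p‖² for all p ∈ H₀ ⊕ H₁ and Re⟨M₁₂₂ y, y⟩ ≥ c₁‖y‖² for all y ∈ Y. Define J ∈ L(Y; H₀ ⊕ H₁) by J := ½((M₁₀₂ + M₁₂₀*) ⊕-componentwise (M₁₁₂ + M₁₂₁*)), i.e. Jy = ½(M₁₀₂ y + M₁₂₀* y, M₁₁₂ y + M₁₂₁* y). Suppose there is δ > 0 with c₀ − δ‖J‖ > 0 and c₁ − δ⁻¹‖J‖ > 0. Then for all w = (p, y) ∈ (H₀ ⊕ H₁) ⊕ Y, Re⟨z⁻¹ M w, w⟩ ≥ (c₀ − δ‖J‖)‖p‖² + (c₁ − δ⁻¹‖J‖)‖y‖²; in particular Re⟨z⁻¹ M w, w⟩ ≥ min{c₀ − δ‖J‖, c₁ − δ⁻¹‖J‖}·‖w‖² > 0 for all w ≠ 0. -/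
open scoped InnerProductSpace

/-- Cauchy-Schwarz combined with the weighted Young inequality for a bounded operator. -/
lemma neg_le_two_mul_re_inner_apply {E F : Type*}
    [NormedAddCommGroup E] [InnerProductSpace ℂ E] [NormedAddCommGroup F] [InnerProductSpace ℂ F]
    (J : F →L[ℂ] E) {δ : ℝ} (hδ : 0 < δ) (p : E) (y : F) :
    -(δ * ‖J‖ * ‖p‖ ^ 2 + δ⁻¹ * ‖J‖ * ‖y‖ ^ 2) ≤ 2 * (⟪J y, p⟫_ℂ).re := by
  have cauchy_schwarz : -(‖J‖ * ‖y‖ * ‖p‖) ≤ (⟪J y, p⟫_ℂ).re :=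
    calc -(‖J‖ * ‖y‖ * ‖p‖) ≤ -(‖J y‖ * ‖p‖) := by
          gcongr
          exact J.le_opNorm y
      _ ≤ -‖⟪J y, p⟫_ℂ‖ := neg_le_neg (norm_inner_le_norm _ _)
      _ ≤ (⟪J y, p⟫_ℂ).re := (abs_le.mp (Complex.abs_re_le_norm _)).1
  have young : 2 * (‖y‖ * ‖p‖) ≤ δ * ‖p‖ ^ 2 + δ⁻¹ * ‖y‖ ^ 2 := by
    have square : δ * ‖p‖ ^ 2 + δ⁻¹ * ‖y‖ ^ 2 - 2 * (‖y‖ * ‖p‖)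
        = δ⁻¹ * (δ * ‖p‖ - ‖y‖) ^ 2 := by
      field_simp
      ring
    have : 0 ≤ δ⁻¹ * (δ * ‖p‖ - ‖y‖) ^ 2 := by positivity
    linarith
  linarith [mul_le_mul_of_nonneg_left young (norm_nonneg J)]

theorem stmt_7 {H₀ H₁ Y : Type*}
    [NormedAddCommGroup H₀] [InnerProductSpace ℂ H₀] [CompleteSpace H₀]
    [NormedAddCommGroup H₁] [InnerProductSpace ℂ H₁] [CompleteSpace H₁]
    [NormedAddCommGroup Y] [InnerProductSpace ℂ Y] [CompleteSpace Y]
    (K : WithLp 2 (H₀ × H₁) →L[ℂ] WithLp 2 (H₀ × H₁))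
    (M102 : Y →L[ℂ] H₀) (M112 : Y →L[ℂ] H₁)
    (M120 : H₀ →L[ℂ] Y) (M121 : H₁ →L[ℂ] Y) (M122 : Y →L[ℂ] Y)
    (z : ℂ) (hz : z ≠ 0)
    -- the block operator `M`:
    (M : WithLp 2 (WithLp 2 (H₀ × H₁) × Y) →L[ℂ] WithLp 2 (WithLp 2 (H₀ × H₁) × Y))
    (hM : ∀ (p₀ : H₀) (p₁ : H₁) (y : Y),
      M ((WithLp.equiv 2 (WithLp 2 (H₀ × H₁) × Y)).symm
          ((WithLp.equiv 2 (H₀ × H₁)).symm (p₀, p₁), y))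
        = (WithLp.equiv 2 (WithLp 2 (H₀ × H₁) × Y)).symm
            (K ((WithLp.equiv 2 (H₀ × H₁)).symm (p₀, p₁))
                + z • (WithLp.equiv 2 (H₀ × H₁)).symm (M102 y, M112 y),
              z • (M120 p₀ + M121 p₁ + M122 y)))
    -- the operator `J = ½((M₁₀₂ + M₁₂₀*), (M₁₁₂ + M₁₂₁*))`:
    (J : Y →L[ℂ] WithLp 2 (H₀ × H₁))
    (hJ : ∀ y : Y, J y = (WithLp.equiv 2 (H₀ × H₁)).symm
        (((1 : ℂ) / 2) • (M102 y + ContinuousLinearMap.adjoint M120 y),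
          ((1 : ℂ) / 2) • (M112 y + ContinuousLinearMap.adjoint M121 y)))
    (c₀ c₁ : ℝ) (hc₀ : 0 < c₀) (hc₁ : 0 < c₁)
    (hK : ∀ p : WithLp 2 (H₀ × H₁), c₀ * ‖p‖ ^ 2 ≤ (⟪z⁻¹ • K p, p⟫_ℂ).re)
    (hM122 : ∀ y : Y, c₁ * ‖y‖ ^ 2 ≤ (⟪M122 y, y⟫_ℂ).re)
    (δ : ℝ) (hδ : 0 < δ) (hδ₀ : 0 < c₀ - δ * ‖J‖) (hδ₁ : 0 < c₁ - δ⁻¹ * ‖J‖) :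
    (∀ (p : WithLp 2 (H₀ × H₁)) (y : Y),
      (c₀ - δ * ‖J‖) * ‖p‖ ^ 2 + (c₁ - δ⁻¹ * ‖J‖) * ‖y‖ ^ 2
        ≤ (⟪z⁻¹ • M ((WithLp.equiv 2 (WithLp 2 (H₀ × H₁) × Y)).symm (p, y)),
            (WithLp.equiv 2 (WithLp 2 (H₀ × H₁) × Y)).symm (p, y)⟫_ℂ).re) ∧
    ∀ w : WithLp 2 (WithLp 2 (H₀ × H₁) × Y), w ≠ 0 →
      min (c₀ - δ * ‖J‖) (c₁ - δ⁻¹ * ‖J‖) * ‖w‖ ^ 2 ≤ (⟪z⁻¹ • M w, w⟫_ℂ).re ∧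
      0 < (⟪z⁻¹ • M w, w⟫_ℂ).re := by
  have expand (p : WithLp 2 (H₀ × H₁)) (y : Y) :
      (⟪z⁻¹ • M ((WithLp.equiv 2 (WithLp 2 (H₀ × H₁) × Y)).symm (p, y)),
          (WithLp.equiv 2 (WithLp 2 (H₀ × H₁) × Y)).symm (p, y)⟫_ℂ).re
        = (⟪z⁻¹ • K p, p⟫_ℂ).re + (⟪M122 y, y⟫_ℂ).re + 2 * (⟪J y, p⟫_ℂ).re := by
    obtain ⟨p₀, p₁⟩ := p
    have swap₀ : (⟪M120 p₀, y⟫_ℂ).re = (⟪ContinuousLinearMap.adjoint M120 y, p₀⟫_ℂ).re := by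
      rw [ContinuousLinearMap.adjoint_inner_left]
      exact inner_re_symm (𝕜 := ℂ) _ _
    have swap₁ : (⟪M121 p₁, y⟫_ℂ).re = (⟪ContinuousLinearMap.adjoint M121 y, p₁⟫_ℂ).re := by
      rw [ContinuousLinearMap.adjoint_inner_left]
      exact inner_re_symm (𝕜 := ℂ) _ _
    have hMw := hM p₀ p₁ y
    simp only [WithLp.equiv_symm_apply] at hMw hJ ⊢
    rw [hMw, hJ, ← WithLp.toLp_smul, Prod.smul_mk, smul_add, inv_smul_smul₀ hz,
      inv_smul_smul₀ hz]
    have half (a : ℂ) : ((1 / 2 : ℂ) * a).re = a.re / 2 := by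
      rw [show (1 / 2 : ℂ) * a = a / 2 by ring]
      simp
    have conj_half : (starRingEnd ℂ) (1 / 2 : ℂ) = 1 / 2 := by simp [Complex.conj_ofNat]
    simp only [WithLp.prod_inner_apply, inner_add_left, inner_smul_left _ _ (1 / 2 : ℂ),
      conj_half, Complex.add_re, half, swap₀, swap₁]
    ring
  have coercive (p : WithLp 2 (H₀ × H₁)) (y : Y) :
      (c₀ - δ * ‖J‖) * ‖p‖ ^ 2 + (c₁ - δ⁻¹ * ‖J‖) * ‖y‖ ^ 2
        ≤ (⟪z⁻¹ • M ((WithLp.equiv 2 (WithLp 2 (H₀ × H₁) × Y)).symm (p, y)),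
            (WithLp.equiv 2 (WithLp 2 (H₀ × H₁) × Y)).symm (p, y)⟫_ℂ).re := by
    rw [expand]
    linarith [hK p, hM122 y, neg_le_two_mul_re_inner_apply J hδ p y]
  refine ⟨coercive, fun w hw => ?_⟩
  have lower : min (c₀ - δ * ‖J‖) (c₁ - δ⁻¹ * ‖J‖) * ‖w‖ ^ 2 ≤ (⟪z⁻¹ • M w, w⟫_ℂ).re :=
    calc min (c₀ - δ * ‖J‖) (c₁ - δ⁻¹ * ‖J‖) * ‖w‖ ^ 2
        ≤ (c₀ - δ * ‖J‖) * ‖w.fst‖ ^ 2 + (c₁ - δ⁻¹ * ‖J‖) * ‖w.snd‖ ^ 2 := by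
          rw [WithLp.prod_norm_sq_eq_of_L2, mul_add]
          gcongr
          · exact min_le_left _ _
          · exact min_le_right _ _
      _ ≤ (⟪z⁻¹ • M w, w⟫_ℂ).re := coercive w.fst w.snd
  have := lt_min hδ₀ hδ₁
  have := norm_pos_iff.mpr hw
  exact ⟨lower, lower.trans_lt' (by positivity)⟩
end

section
/- Let ν > 0 and let H be a complex Hilbert space. For every f ∈ H_{ν,0}(ℝ; H) and every x ∈ ℝ, the function f is Bochner integrable on (−∞, x], and the function Jf defined by (Jf)(x) := ∫_{−∞}^{x} f(t) dt belongs to H_{ν,0}(ℝ; H) with ‖Jf‖_{ν,0} ≤ (1/ν)‖f‖_{ν,0}. Hence J is a bounded linear operator on H_{ν,0}(ℝ; H) of norm at most 1/ν. -/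
open MeasureTheory

section HalfLineIntegral

variable {H : Type*} [NormedAddCommGroup H]

lemma setIntegral_Iic_eq_integral_indicator [NormedSpace ℝ H] (f : ℝ → H) (x : ℝ) :
    ∫ t in Set.Iic x, f t = ∫ t, {p : ℝ × ℝ | p.2 ≤ p.1}.indicator (fun p => f p.2) (x, t) := by
  rw [← integral_indicator measurableSet_Iic]
  rfl

lemma aestronglyMeasurable_indicator_snd_le_fst {f : ℝ → H}
    (hf : AEStronglyMeasurable f (volume : Measure ℝ)) :
    AEStronglyMeasurable ({p : ℝ × ℝ | p.2 ≤ p.1}.indicator (fun p => f p.2))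
      ((volume : Measure ℝ).prod volume) :=
  hf.comp_snd.indicator (measurableSet_le measurable_snd measurable_fst)

lemma aestronglyMeasurable_setIntegral_Iic [NormedSpace ℝ H] {f : ℝ → H}
    (hf : AEStronglyMeasurable f (volume : Measure ℝ)) :
    AEStronglyMeasurable (fun x : ℝ => ∫ t in Set.Iic x, f t) volume := by
  simp_rw [setIntegral_Iic_eq_integral_indicator]
  exact (aestronglyMeasurable_indicator_snd_le_fst hf).integral_prod_right'

lemma integrableOn_norm_sq_mul_exp_Iic {ν : ℝ} (hν : 0 < ν) {f : ℝ → H}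
    (hf_meas : AEStronglyMeasurable f (volume : Measure ℝ))
    (hf : Integrable (fun t : ℝ => ‖f t‖ ^ 2 * Real.exp (-2 * ν * t))) (x : ℝ) :
    IntegrableOn (fun t : ℝ => ‖f t‖ ^ 2 * Real.exp (-ν * t)) (Set.Iic x) := by
  refine ((hf.mul_const (Real.exp (ν * x))).integrableOn (s := Set.Iic x)).mono'
    ((hf_meas.norm.pow 2).mul (by fun_prop : Continuous fun t : ℝ =>
      Real.exp (-ν * t)).aestronglyMeasurable).restrict ?_
  filter_upwards [ae_restrict_mem measurableSet_Iic] with t ht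
  rw [Real.norm_of_nonneg (by positivity), mul_assoc, ← Real.exp_add]
  gcongr
  nlinarith [Set.mem_Iic.mp ht]

lemma two_mul_mul_norm_le_exp (ν c t : ℝ) (v : H) :
    2 * c * ‖v‖ ≤ c ^ 2 * Real.exp (ν * t) + ‖v‖ ^ 2 * Real.exp (-ν * t) := by
  have h : Real.exp (ν * t) * Real.exp (-ν * t) = 1 := by
    rw [← Real.exp_add]; simp
  have key := mul_nonneg (Real.exp_pos (-ν * t)).le
    (sq_nonneg (c * Real.exp (ν * t) - ‖v‖))
  have expand : Real.exp (-ν * t) * (c * Real.exp (ν * t) - ‖v‖) ^ 2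
      = c ^ 2 * Real.exp (ν * t) * (Real.exp (ν * t) * Real.exp (-ν * t))
        - 2 * c * ‖v‖ * (Real.exp (ν * t) * Real.exp (-ν * t))
        + ‖v‖ ^ 2 * Real.exp (-ν * t) := by ring
  rw [expand, h] at key
  linarith

lemma integrableOn_Iic_of_integrable_norm_sq_mul_exp {ν : ℝ} (hν : 0 < ν) {f : ℝ → H}
    (hf_meas : AEStronglyMeasurable f (volume : Measure ℝ))
    (hf : Integrable (fun t : ℝ => ‖f t‖ ^ 2 * Real.exp (-2 * ν * t))) (x : ℝ) :
    IntegrableOn f (Set.Iic x) := by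
  refine Integrable.mono' ((integrableOn_exp_mul_Iic hν x).add
    (integrableOn_norm_sq_mul_exp_Iic hν hf_meas hf x)) hf_meas.restrict ?_
  refine Filter.Eventually.of_forall fun t => ?_
  have := two_mul_mul_norm_le_exp ν 1 t (f t)
  simp only [Pi.add_apply]
  linarith [norm_nonneg (f t)]

lemma norm_setIntegral_Iic_sq_le [NormedSpace ℝ H] {ν : ℝ} (hν : 0 < ν) {f : ℝ → H}
    (hf_meas : AEStronglyMeasurable f (volume : Measure ℝ))
    (hf : Integrable (fun t : ℝ => ‖f t‖ ^ 2 * Real.exp (-2 * ν * t))) (x : ℝ) :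
    ‖∫ t in Set.Iic x, f t‖ ^ 2 ≤
      Real.exp (ν * x) / ν * ∫ t in Set.Iic x, ‖f t‖ ^ 2 * Real.exp (-ν * t) := by
  have hA : 0 < Real.exp (ν * x) / ν := by positivity
  have hle := norm_integral_le_integral_norm (μ := volume.restrict (Set.Iic x)) f
  have hint : ∀ c : ℝ, 2 * c * ∫ t in Set.Iic x, ‖f t‖ ≤
      c ^ 2 * (Real.exp (ν * x) / ν) + ∫ t in Set.Iic x, ‖f t‖ ^ 2 * Real.exp (-ν * t) := by
    intro c
    have h₁ := (integrableOn_exp_mul_Iic hν x).const_mul (c ^ 2)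
    have h₂ := integrableOn_norm_sq_mul_exp_Iic hν hf_meas hf x
    rw [← integral_exp_mul_Iic hν, ← integral_const_mul, ← integral_const_mul,
      ← integral_add h₁ h₂]
    exact integral_mono
      ((integrableOn_Iic_of_integrable_norm_sq_mul_exp hν hf_meas hf x).norm.const_mul _)
      (h₁.add h₂) fun t => two_mul_mul_norm_le_exp ν c t (f t)
  set A := Real.exp (ν * x) / ν
  set G := ∫ t in Set.Iic x, ‖f t‖
  set B := ∫ t in Set.Iic x, ‖f t‖ ^ 2 * Real.exp (-ν * t)
  have hG : G ^ 2 ≤ A * B := by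
    have h := mul_le_mul_of_nonneg_left (hint (G / A)) hA.le
    have e₁ : A * (2 * (G / A) * G) = 2 * G ^ 2 := by field_simp
    have e₂ : A * ((G / A) ^ 2 * A + B) = G ^ 2 + A * B := by field_simp
    rw [e₁, e₂] at h
    linarith
  exact (pow_le_pow_left₀ (norm_nonneg _) hle 2).trans hG

/-- The kernel of the double integral to which Fubini's theorem is applied. -/
noncomputable def halfLineKernel (ν : ℝ) (f : ℝ → H) (p : ℝ × ℝ) : ℝ :=
  {p : ℝ × ℝ | p.2 ≤ p.1}.indicator (fun p => ‖f p.2‖ ^ 2 * Real.exp (-ν * p.2)) p *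
    Real.exp (-ν * p.1)

lemma halfLineKernel_nonneg (ν : ℝ) (f : ℝ → H) (p : ℝ × ℝ) : 0 ≤ halfLineKernel ν f p :=
  mul_nonneg (Set.indicator_nonneg (fun _ _ => by positivity) _) (Real.exp_pos _).le

lemma halfLineKernel_section (ν : ℝ) (f : ℝ → H) (t : ℝ) :
    (fun x => halfLineKernel ν f (x, t)) = (Set.Ici t).indicator
      fun x => ‖f t‖ ^ 2 * Real.exp (-ν * t) * Real.exp (-ν * x) := by
  ext x
  by_cases h : t ≤ x <;> simp [halfLineKernel, Set.indicator, h]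

lemma integral_halfLineKernel_snd (ν : ℝ) (f : ℝ → H) (x : ℝ) :
    ∫ t, halfLineKernel ν f (x, t) =
      (∫ t in Set.Iic x, ‖f t‖ ^ 2 * Real.exp (-ν * t)) * Real.exp (-ν * x) := by
  rw [setIntegral_Iic_eq_integral_indicator, ← integral_mul_const]
  rfl

lemma integral_halfLineKernel_fst {ν : ℝ} (hν : 0 < ν) (f : ℝ → H) (t : ℝ) :
    ∫ x, halfLineKernel ν f (x, t) = 1 / ν * (‖f t‖ ^ 2 * Real.exp (-2 * ν * t)) := by
  have h : Real.exp (-2 * ν * t) = Real.exp (-ν * t) * Real.exp (-ν * t) := by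
    rw [← Real.exp_add]; ring_nf
  rw [halfLineKernel_section, integral_indicator measurableSet_Ici, integral_const_mul,
    integral_Ici_eq_integral_Ioi, integral_exp_mul_Ioi (neg_lt_zero.mpr hν), h]
  field_simp

lemma integrable_halfLineKernel {ν : ℝ} (hν : 0 < ν) {f : ℝ → H}
    (hf_meas : AEStronglyMeasurable f (volume : Measure ℝ))
    (hf : Integrable (fun t : ℝ => ‖f t‖ ^ 2 * Real.exp (-2 * ν * t))) :
    Integrable (halfLineKernel ν f) ((volume : Measure ℝ).prod volume) := by
  have hmeas : AEStronglyMeasurable (halfLineKernel ν f) ((volume : Measure ℝ).prod volume) :=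
    (aestronglyMeasurable_indicator_snd_le_fst
      ((hf_meas.norm.pow 2).mul (by fun_prop : Continuous fun t : ℝ =>
        Real.exp (-ν * t)).aestronglyMeasurable)).mul
      (by fun_prop : Continuous fun p : ℝ × ℝ => Real.exp (-ν * p.1)).aestronglyMeasurable
  rw [integrable_prod_iff' hmeas]
  constructor
  · refine Filter.Eventually.of_forall fun t => ?_
    rw [halfLineKernel_section, integrable_indicator_iff measurableSet_Ici,
      integrableOn_Ici_iff_integrableOn_Ioi]
    exact (integrableOn_exp_mul_Ioi (neg_lt_zero.mpr hν) t).const_mul _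
  · simp_rw [Real.norm_of_nonneg (halfLineKernel_nonneg ν f _), integral_halfLineKernel_fst hν]
    exact hf.const_mul _

end HalfLineIntegral

theorem stmt_9 {H : Type*}
    [NormedAddCommGroup H] [InnerProductSpace ℂ H] [CompleteSpace H]
    (ν : ℝ) (hν : 0 < ν) (f : ℝ → H)
    (hf_meas : AEStronglyMeasurable f (volume : Measure ℝ))
    (hf : Integrable (fun t : ℝ => ‖f t‖ ^ 2 * Real.exp (-2 * ν * t))) :
    -- `f` is Bochner integrable on every half line `(-∞, x]` ...
    (∀ x : ℝ, IntegrableOn f (Set.Iic x)) ∧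
    -- ... `Jf` belongs to `H_{ν,0}(ℝ; H)` ...
    Integrable (fun x : ℝ => ‖∫ t in Set.Iic x, f t‖ ^ 2 * Real.exp (-2 * ν * x)) ∧
    -- ... and `‖Jf‖_{ν,0} ≤ (1/ν) ‖f‖_{ν,0}` (squared form):
    (∫ x : ℝ, ‖∫ t in Set.Iic x, f t‖ ^ 2 * Real.exp (-2 * ν * x))
      ≤ (1 / ν) ^ 2 * ∫ t : ℝ, ‖f t‖ ^ 2 * Real.exp (-2 * ν * t) := by
  have hker := integrable_halfLineKernel hν hf_meas hf
  have hdom : Integrable fun x => 1 / ν * ∫ t, halfLineKernel ν f (x, t) :=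
    hker.integral_prod_left.const_mul _
  have hbound : ∀ x : ℝ, ‖∫ t in Set.Iic x, f t‖ ^ 2 * Real.exp (-2 * ν * x) ≤
      1 / ν * ∫ t, halfLineKernel ν f (x, t) := by
    intro x
    refine (mul_le_mul_of_nonneg_right (norm_setIntegral_Iic_sq_le hν hf_meas hf x)
      (Real.exp_pos _).le).trans_eq ?_
    have h : Real.exp (-ν * x) = Real.exp (ν * x) * Real.exp (-2 * ν * x) := by
      rw [← Real.exp_add]; ring_nf
    rw [integral_halfLineKernel_snd, h]
    ring
  have hJ : Integrable fun x : ℝ =>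
      ‖∫ t in Set.Iic x, f t‖ ^ 2 * Real.exp (-2 * ν * x) := by
    refine hdom.mono' (((aestronglyMeasurable_setIntegral_Iic hf_meas).norm.pow 2).mul
      (by fun_prop : Continuous fun t : ℝ => Real.exp (-2 * ν * t)).aestronglyMeasurable)
      (Filter.Eventually.of_forall fun x => ?_)
    rw [Real.norm_of_nonneg (by positivity)]
    exact hbound x
  refine ⟨integrableOn_Iic_of_integrable_norm_sq_mul_exp hν hf_meas hf, hJ,
    (integral_mono hJ hdom hbound).trans_eq ?_⟩
  rw [integral_const_mul, integral_integral_swap (f := fun x t => halfLineKernel ν f (x, t)) hker]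
  simp_rw [integral_halfLineKernel_fst hν]
  rw [integral_const_mul]
  ring
end

section
/- Let ν̃ : BD(G) → BD(D) be a bounded linear operator (with respect to the graph norms) such that ⟨(Ḋ ν̃ + ν̃* Ġ)φ, φ⟩_{BD(G)} > 0 for every φ ∈ BD(G) \ {0}, where Ġ : BD(G) → BD(D), u ↦ Gu, and Ḋ : BD(D) → BD(G), ζ ↦ Dζ, and ν̃* is the adjoint of ν̃. Then the sesquilinear form ⟨f, g⟩_U := ½(⟨ν̃ f, Ġ g⟩_{BD(D)} + ⟨Ġ f, ν̃ g⟩_{BD(D)}) defines an inner product on BD(G): it is sesquilinear, Hermitian, and positive definite. -/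
open scoped InnerProductSpace

/-- The sesquilinear form `⟨f, g⟩_U := ½(⟨ν̃ f, Ġ g⟩_{BD(D)} + ⟨Ġ f, ν̃ g⟩_{BD(D)})`, where the
inner product of `BD(D)` is the graph inner product of `D`, `N` represents `ν̃` and `Gd`
represents `Ġ`. -/
noncomputable def Uform {H₀ H₁ : Type*}
    [NormedAddCommGroup H₀] [InnerProductSpace ℂ H₀]
    [NormedAddCommGroup H₁] [InnerProductSpace ℂ H₁]
    (G : H₀ →ₗ.[ℂ] H₁) (D : H₁ →ₗ.[ℂ] H₀)
    (N Gd : G.domain → D.domain) (f g : G.domain) : ℂ :=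
  (1 / 2) * ((⟪(N f : H₁), (Gd g : H₁)⟫_ℂ + ⟪D (N f), D (Gd g)⟫_ℂ)
    + (⟪(Gd f : H₁), (N g : H₁)⟫_ℂ + ⟪D (Gd f), D (N g)⟫_ℂ))

/-- If `B = -A₀*` and `y` represents `A ζ` for `ζ` in the boundary data space of `A`,
then `B y = ζ`. -/
theorem neg_adjoint_apply_of_mem_boundaryData {E F : Type*}
    [NormedAddCommGroup E] [InnerProductSpace ℂ E] [CompleteSpace E]
    [NormedAddCommGroup F] [InnerProductSpace ℂ F]
    {A₀ A : E →ₗ.[ℂ] F} {B : F →ₗ.[ℂ] E} (hdense : Dense (A₀.domain : Set E))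
    (hB : B = -A₀.adjoint) {ζ : A.domain} (hζ : ζ ∈ boundaryData A₀ A)
    {y : B.domain} (hy : (y : F) = A ζ) : B y = ζ := by
  subst hB
  refine hdense.eq_of_inner_left ℂ fun w hw => ?_
  have h1 : ⟪A₀.adjoint y, w⟫_ℂ = ⟪(y : F), A₀ ⟨w, hw⟩⟫_ℂ :=
    A₀.adjoint_isFormalAdjoint hdense y ⟨w, hw⟩
  have h2 := congrArg (starRingEnd ℂ) (hζ ⟨w, hw⟩)
  simp only [map_add, inner_conj_symm, map_zero] at h2
  rw [LinearPMap.neg_apply, inner_neg_left]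
  refine (congrArg Neg.neg h1).trans ?_
  rw [hy]
  linear_combination -h2

theorem add_mem_boundaryData {E F : Type*}
    [NormedAddCommGroup E] [InnerProductSpace ℂ E]
    [NormedAddCommGroup F] [InnerProductSpace ℂ F]
    {A₀ A : E →ₗ.[ℂ] F} {u v : A.domain} (hu : u ∈ boundaryData A₀ A)
    (hv : v ∈ boundaryData A₀ A) : u + v ∈ boundaryData A₀ A := fun w => by
  rw [LinearPMap.map_add, Submodule.coe_add, inner_add_right, inner_add_right]
  linear_combination hu w + hv w

theorem smul_mem_boundaryData {E F : Type*}
    [NormedAddCommGroup E] [InnerProductSpace ℂ E]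
    [NormedAddCommGroup F] [InnerProductSpace ℂ F]
    {A₀ A : E →ₗ.[ℂ] F} (c : ℂ) {u : A.domain} (hu : u ∈ boundaryData A₀ A) :
    c • u ∈ boundaryData A₀ A := fun w => by
  rw [LinearPMap.map_smul, Submodule.coe_smul, inner_smul_right, inner_smul_right]
  linear_combination c * hu w

theorem stmt_12 {H₀ H₁ : Type*}
    [NormedAddCommGroup H₀] [InnerProductSpace ℂ H₀] [CompleteSpace H₀]
    [NormedAddCommGroup H₁] [InnerProductSpace ℂ H₁] [CompleteSpace H₁]
    (G₀ : H₀ →ₗ.[ℂ] H₁) (D₀ : H₁ →ₗ.[ℂ] H₀)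
    (hG₀dense : Dense (G₀.domain : Set H₀)) (hD₀dense : Dense (D₀.domain : Set H₁))
    (hG₀closed : G₀.IsClosed) (hD₀closed : D₀.IsClosed)
    (hskew : ∀ (u : G₀.domain) (v : D₀.domain),
      ⟪G₀ u, (v : H₁)⟫_ℂ = - ⟪(u : H₀), D₀ v⟫_ℂ)
    (G : H₀ →ₗ.[ℂ] H₁) (D : H₁ →ₗ.[ℂ] H₀)
    (hG : G = - D₀.adjoint) (hD : D = - G₀.adjoint)
    -- `Ġ` and `Ḋ`, realized as total maps agreeing with `G` resp. `D` on the boundary data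
    -- spaces and mapping `BD(G)` into `BD(D)` resp. `BD(D)` into `BD(G)`:
    (Gd : G.domain → D.domain)
    (hGd : ∀ u : G.domain, u ∈ boundaryData G₀ G →
      (Gd u : H₁) = G u ∧ Gd u ∈ boundaryData D₀ D)
    (Dd : D.domain → G.domain)
    (hDd : ∀ ζ : D.domain, ζ ∈ boundaryData D₀ D →
      (Dd ζ : H₀) = D ζ ∧ Dd ζ ∈ boundaryData G₀ G)
    -- `ν̃ : BD(G) → BD(D)` is linear and bounded w.r.t. the graph norms:
    (N : G.domain → D.domain)
    (hNmem : ∀ u : G.domain, u ∈ boundaryData G₀ G → N u ∈ boundaryData D₀ D)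
    (hNadd : ∀ u v : G.domain, u ∈ boundaryData G₀ G → v ∈ boundaryData G₀ G →
      N (u + v) = N u + N v)
    (hNsmul : ∀ (c : ℂ) (u : G.domain), u ∈ boundaryData G₀ G → N (c • u) = c • N u)
    (hNbdd : ∃ C : ℝ, ∀ u : G.domain, u ∈ boundaryData G₀ G →
      Real.sqrt (‖(N u : H₁)‖ ^ 2 + ‖D (N u)‖ ^ 2)
        ≤ C * Real.sqrt (‖(u : H₀)‖ ^ 2 + ‖G u‖ ^ 2))
    -- `ν̃* : BD(D) → BD(G)` is the adjoint of `ν̃` w.r.t. the graph inner products: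
    (Ns : D.domain → G.domain)
    (hNsmem : ∀ ζ : D.domain, ζ ∈ boundaryData D₀ D → Ns ζ ∈ boundaryData G₀ G)
    (hNs : ∀ (u : G.domain) (ζ : D.domain), u ∈ boundaryData G₀ G → ζ ∈ boundaryData D₀ D →
      ⟪(N u : H₁), (ζ : H₁)⟫_ℂ + ⟪D (N u), D ζ⟫_ℂ
        = ⟪(u : H₀), (Ns ζ : H₀)⟫_ℂ + ⟪G u, G (Ns ζ)⟫_ℂ)
    -- positivity: `⟨(Ḋν̃ + ν̃*Ġ)φ, φ⟩_{BD(G)} > 0` for `φ ∈ BD(G) \ {0}`: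
    (hpos : ∀ φ : G.domain, φ ∈ boundaryData G₀ G → φ ≠ 0 →
      0 < (⟪((Dd (N φ) + Ns (Gd φ) : G.domain) : H₀), (φ : H₀)⟫_ℂ
            + ⟪G (Dd (N φ) + Ns (Gd φ)), G φ⟫_ℂ).re) :
    -- `⟨·,·⟩_U` is additive and linear in the second argument on `BD(G)` ...
    (∀ f g g' : G.domain, f ∈ boundaryData G₀ G → g ∈ boundaryData G₀ G →
      g' ∈ boundaryData G₀ G →
        Uform G D N Gd f (g + g') = Uform G D N Gd f g + Uform G D N Gd f g') ∧
    (∀ (c : ℂ) (f g : G.domain), f ∈ boundaryData G₀ G → g ∈ boundaryData G₀ G →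
        Uform G D N Gd f (c • g) = c * Uform G D N Gd f g) ∧
    -- ... additive and conjugate-linear in the first argument ...
    (∀ f f' g : G.domain, f ∈ boundaryData G₀ G → f' ∈ boundaryData G₀ G →
      g ∈ boundaryData G₀ G →
        Uform G D N Gd (f + f') g = Uform G D N Gd f g + Uform G D N Gd f' g) ∧
    (∀ (c : ℂ) (f g : G.domain), f ∈ boundaryData G₀ G → g ∈ boundaryData G₀ G →
        Uform G D N Gd (c • f) g = (starRingEnd ℂ) c * Uform G D N Gd f g) ∧
    -- ... Hermitian ...
    (∀ f g : G.domain, f ∈ boundaryData G₀ G → g ∈ boundaryData G₀ G →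
        Uform G D N Gd f g = (starRingEnd ℂ) (Uform G D N Gd g f)) ∧
    -- ... and positive definite:
    (∀ f : G.domain, f ∈ boundaryData G₀ G → f ≠ 0 →
        0 < (Uform G D N Gd f f).re ∧ (Uform G D N Gd f f).im = 0) := by
  have hDGd : ∀ u : G.domain, u ∈ boundaryData G₀ G → D (Gd u) = (u : H₀) := fun u hu =>
    neg_adjoint_apply_of_mem_boundaryData hG₀dense hD hu (hGd u hu).1
  have hGDd : ∀ ζ : D.domain, ζ ∈ boundaryData D₀ D → G (Dd ζ) = (ζ : H₁) := fun ζ hζ =>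
    neg_adjoint_apply_of_mem_boundaryData hD₀dense hG hζ (hDd ζ hζ).1
  have hU : ∀ f g : G.domain, f ∈ boundaryData G₀ G → g ∈ boundaryData G₀ G →
      Uform G D N Gd f g = (1 / 2) * ((⟪(N f : H₁), G g⟫_ℂ + ⟪D (N f), (g : H₀)⟫_ℂ)
        + (⟪G f, (N g : H₁)⟫_ℂ + ⟪(f : H₀), D (N g)⟫_ℂ)) := fun f g hf hg => by
    rw [Uform, (hGd f hf).1, (hGd g hg).1, hDGd f hf, hDGd g hg]
  have hherm : ∀ f g : G.domain, f ∈ boundaryData G₀ G → g ∈ boundaryData G₀ G →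
      Uform G D N Gd f g = (starRingEnd ℂ) (Uform G D N Gd g f) := fun f g hf hg => by
    rw [hU f g hf hg, hU g f hg hf]
    simp only [map_mul, map_add, inner_conj_symm, map_div₀, map_one, map_ofNat]
    ring
  refine ⟨fun f g g' hf hg hg' => ?_, fun c f g hf hg => ?_, fun f f' g hf hf' hg => ?_,
    fun c f g hf hg => ?_, hherm, fun f hf hf0 => ⟨?_, ?_⟩⟩
  · rw [hU _ _ hf (add_mem_boundaryData hg hg'), hU _ _ hf hg, hU _ _ hf hg', hNadd g g' hg hg']
    simp only [LinearPMap.map_add, Submodule.coe_add, inner_add_right]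
    ring
  · rw [hU _ _ hf (smul_mem_boundaryData c hg), hU _ _ hf hg, hNsmul c g hg]
    simp only [LinearPMap.map_smul, Submodule.coe_smul, inner_smul_right]
    ring
  · rw [hU _ _ (add_mem_boundaryData hf hf') hg, hU _ _ hf hg, hU _ _ hf' hg, hNadd f f' hf hf']
    simp only [LinearPMap.map_add, Submodule.coe_add, inner_add_left]
    ring
  · rw [hU _ _ (smul_mem_boundaryData c hf) hg, hU _ _ hf hg, hNsmul c f hf]
    simp only [LinearPMap.map_smul, Submodule.coe_smul, inner_smul_left]
    ring
  · have hadj := congrArg (starRingEnd ℂ) (hNs f (Gd f) hf (hGd f hf).2)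
    rw [(hGd f hf).1, hDGd f hf] at hadj
    simp only [map_add, inner_conj_symm] at hadj
    have hN := hNmem f hf
    have hp := hpos f hf hf0
    rw [LinearPMap.map_add, Submodule.coe_add, inner_add_left, inner_add_left,
      (hDd _ hN).1, hGDd _ hN] at hp
    have key : Uform G D N Gd f f = ((1 / 2 : ℝ) : ℂ) *
        (⟪D (N f), (f : H₀)⟫_ℂ + ⟪(Ns (Gd f) : H₀), (f : H₀)⟫_ℂ
          + (⟪(N f : H₁), G f⟫_ℂ + ⟪G (Ns (Gd f)), G f⟫_ℂ)) := by
      rw [hU f f hf hf]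
      push_cast
      linear_combination (1 / 2) * hadj
    rw [key, Complex.re_ofReal_mul]
    exact mul_pos (by norm_num) hp
  · exact Complex.conj_eq_iff_im.1 (hherm f f hf hf).symm
end

section
/- Let ν > 0, let H be a complex Hilbert space, let h ∈ L¹(ℝ_{≥0}; ℂ), g₀ ∈ ℂ, and define g : ℝ_{≥0} → ℂ by g(t) := g₀ + ∫₀^t h(s) ds. Then for every f ∈ H_{ν,0}(ℝ; H) the convolution (g ∗ f)(t) := ∫_{−∞}^{t} g(t − s) f(s) ds is well defined for almost every t, belongs to H_{ν,0}(ℝ; H), and satisfies ‖g ∗ f‖_{ν,0} ≤ (1/ν)(‖h‖_{L¹(ℝ_{≥0})} + |g₀|) ‖f‖_{ν,0}. Hence g∗ is a bounded linear operator on H_{ν,0}(ℝ; H) with norm at most ν⁻¹(‖h‖_{L¹(ℝ_{≥0})} + |g₀|). -/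
open MeasureTheory

/-- Cauchy–Schwarz for the weight `φ`. -/
lemma lintegral_mul_sq_le {α : Type*} [MeasurableSpace α] (μ : Measure α) {φ ψ : α → ENNReal}
    (hφ : AEMeasurable φ μ) (hψ : AEMeasurable ψ μ) :
    (∫⁻ a, φ a * ψ a ∂μ) ^ 2 ≤ (∫⁻ a, φ a ∂μ) * ∫⁻ a, φ a * ψ a ^ 2 ∂μ := by
  have sqrt_sq (x : ENNReal) : (x ^ (1 / 2 : ℝ)) ^ (2 : ℝ) = x := by
    rw [← ENNReal.rpow_mul]; norm_num
  have sqrt_mul (x : ENNReal) : x ^ (1 / 2 : ℝ) * x ^ (1 / 2 : ℝ) = x := by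
    rw [← ENNReal.rpow_add_of_nonneg _ _ (by norm_num) (by norm_num)]; norm_num
  have holder := ENNReal.lintegral_mul_le_Lp_mul_Lq μ Real.HolderConjugate.two_two
    (hφ.pow_const (1 / 2 : ℝ)) ((hφ.pow_const (1 / 2 : ℝ)).mul hψ)
  simp only [Pi.mul_apply, ← mul_assoc, sqrt_mul, sqrt_sq,
    ENNReal.mul_rpow_of_nonneg _ _ (zero_le_two : (0 : ℝ) ≤ 2)] at holder
  calc (∫⁻ a, φ a * ψ a ∂μ) ^ 2
      ≤ ((∫⁻ a, φ a ∂μ) ^ (1 / 2 : ℝ) * (∫⁻ a, φ a * ψ a ^ (2 : ℝ) ∂μ) ^ (1 / 2 : ℝ)) ^ 2 := by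
        gcongr
    _ = _ := by
        rw [← ENNReal.rpow_two, ENNReal.mul_rpow_of_nonneg _ _ zero_le_two, sqrt_sq, sqrt_sq]
        simp only [ENNReal.rpow_two]

/-- Young's inequality `‖K ∗ F‖₂ ≤ ‖K‖₁ ‖F‖₂` for nonnegative functions on the line. -/
lemma lintegral_convolution_sq_le {K F : ℝ → ENNReal} (hK : Measurable K) (hF : AEMeasurable F) :
    ∫⁻ t, (∫⁻ s, K (t - s) * F s) ^ 2 ≤ (∫⁻ u, K u) ^ 2 * ∫⁻ s, F s ^ 2 := by
  have hmeas : AEMeasurable (Function.uncurry fun t s : ℝ => K (t - s) * F s ^ 2)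
      (volume.prod volume) :=
    (hK.comp measurable_sub).aemeasurable.mul (hF.comp_snd.pow_const 2)
  calc ∫⁻ t, (∫⁻ s, K (t - s) * F s) ^ 2
      ≤ ∫⁻ t, (∫⁻ u, K u) * ∫⁻ s, K (t - s) * F s ^ 2 := by
        refine lintegral_mono fun t => ?_
        have := lintegral_mul_sq_le volume
          (by fun_prop : Measurable fun s => K (t - s)).aemeasurable hF
        rwa [lintegral_sub_left_eq_self K t] at this
    _ = (∫⁻ u, K u) * ∫⁻ t, ∫⁻ s, K (t - s) * F s ^ 2 :=
        lintegral_const_mul'' _ hmeas.lintegral_prod_right'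
    _ = (∫⁻ u, K u) * ∫⁻ s, (∫⁻ u, K u) * F s ^ 2 := by
        rw [lintegral_lintegral_swap hmeas]
        congr 2 with s
        rw [lintegral_mul_const _ (by fun_prop : Measurable fun t => K (t - s)),
          lintegral_sub_right_eq_self K s]
    _ = _ := by
        rw [lintegral_const_mul'' _ (hF.pow_const 2), sq, mul_assoc]

lemma enorm_sq_mul_ofReal_exp {E : Type*} [NormedAddCommGroup E] (x : E) (ν t : ℝ) :
    (‖x‖ₑ * ENNReal.ofReal (Real.exp (-ν * t))) ^ 2
      = ENNReal.ofReal (‖x‖ ^ 2 * Real.exp (-2 * ν * t)) := by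
  rw [← ofReal_norm, ← ENNReal.ofReal_mul (norm_nonneg _),
    ← ENNReal.ofReal_pow (by positivity), mul_pow, ← Real.exp_nat_mul]
  congr 3
  push_cast
  ring

/-- Convolution with a kernel supported on `[0, ∞)` and bounded there by `C` acts on the
exponentially weighted `L²` space with norm at most `C / ν`. -/
lemma weighted_convolution_bound {H : Type*} [NormedAddCommGroup H] [NormedSpace ℂ H]
    {ν : ℝ} (hν : 0 < ν) {G : ℝ → ℂ} (hG : Measurable G) {C : ℝ} (hC : 0 ≤ C)
    (hG_neg : ∀ u < 0, G u = 0) (hG_le : ∀ u, ‖G u‖ ≤ C)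
    {f : ℝ → H} (hf_meas : AEStronglyMeasurable f)
    (hf : Integrable (fun t : ℝ => ‖f t‖ ^ 2 * Real.exp (-2 * ν * t))) :
    (∀ᵐ t : ℝ, Integrable fun s : ℝ => G (t - s) • f s) ∧
    Integrable (fun t : ℝ => ‖∫ s, G (t - s) • f s‖ ^ 2 * Real.exp (-2 * ν * t)) ∧
    (∫ t : ℝ, ‖∫ s, G (t - s) • f s‖ ^ 2 * Real.exp (-2 * ν * t))
      ≤ ((1 / ν) * C) ^ 2 * ∫ t : ℝ, ‖f t‖ ^ 2 * Real.exp (-2 * ν * t) := by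
  set e : ℝ → ENNReal := fun t => ENNReal.ofReal (Real.exp (-ν * t)) with he
  have he_meas : Measurable e := by fun_prop
  set K : ℝ → ENNReal :=
    (Set.Ici 0).indicator fun u => ENNReal.ofReal (C * Real.exp (-ν * u)) with hK
  have hK_meas : Measurable K := Measurable.indicator (by fun_prop) measurableSet_Ici
  set F : ℝ → ENNReal := fun s => ‖f s‖ₑ * e s with hF
  have hF_meas : AEMeasurable F := hf_meas.enorm.mul he_meas.aemeasurable
  have hK_int : ∫⁻ u, K u = ENNReal.ofReal ((1 / ν) * C) := by
    rw [hK, lintegral_indicator measurableSet_Ici, setLIntegral_congr Ioi_ae_eq_Ici.symm,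
      ← ofReal_integral_eq_lintegral_ofReal
        ((integrableOn_exp_mul_Ioi (neg_lt_zero.2 hν) 0).const_mul C)
        (.of_forall fun u => by positivity),
      integral_const_mul, integral_exp_mul_Ioi (neg_lt_zero.2 hν)]
    congr 1
    simp [div_eq_mul_inv, mul_comm]
  have hF_int : ∫⁻ s, F s ^ 2
      = ENNReal.ofReal (∫ t : ℝ, ‖f t‖ ^ 2 * Real.exp (-2 * ν * t)) := by
    rw [ofReal_integral_eq_lintegral_ofReal hf (.of_forall fun t => by positivity)]
    exact lintegral_congr fun t => enorm_sq_mul_ofReal_exp (f t) ν t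
  have hprod : AEStronglyMeasurable (fun p : ℝ × ℝ => G (p.1 - p.2) • f p.2)
      (volume.prod volume) :=
    (hG.comp measurable_sub).aestronglyMeasurable.smul hf_meas.comp_snd
  have hpoint (t : ℝ) :
      (∫⁻ s, ‖G (t - s) • f s‖ₑ) * e t ≤ ∫⁻ s, K (t - s) * F s := by
    rw [← lintegral_mul_const' _ _ ENNReal.ofReal_ne_top]
    refine lintegral_mono fun s => ?_
    rcases lt_or_ge (t - s) 0 with hu | hu
    · simp [hG_neg _ hu]
    · have hexp : e t = ENNReal.ofReal (Real.exp (-ν * (t - s))) * e s := by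
        simp only [he]
        rw [← ENNReal.ofReal_mul (Real.exp_nonneg _), ← Real.exp_add]
        congr 2
        ring
      have hle : ‖G (t - s)‖ₑ ≤ ENNReal.ofReal C := by
        rw [← ofReal_norm]
        exact ENNReal.ofReal_le_ofReal (hG_le _)
      rw [hK, Set.indicator_of_mem (show t - s ∈ Set.Ici 0 from hu), enorm_smul,
        ENNReal.ofReal_mul hC]
      calc ‖G (t - s)‖ₑ * ‖f s‖ₑ * e t
          = ‖G (t - s)‖ₑ * ENNReal.ofReal (Real.exp (-ν * (t - s))) * F s := by
            rw [hexp, hF]; ring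
        _ ≤ _ := by gcongr
  have hbound : ∫⁻ t, ((∫⁻ s, ‖G (t - s) • f s‖ₑ) * e t) ^ 2
      ≤ ENNReal.ofReal
        (((1 / ν) * C) ^ 2 * ∫ t : ℝ, ‖f t‖ ^ 2 * Real.exp (-2 * ν * t)) := by
    rw [ENNReal.ofReal_mul (by positivity), ENNReal.ofReal_pow (by positivity), ← hK_int, ← hF_int]
    refine le_trans (lintegral_mono fun t => ?_) (lintegral_convolution_sq_le hK_meas hF_meas)
    gcongr
    exact hpoint t
  have hconv : ∫⁻ t, ENNReal.ofReal (‖∫ s, G (t - s) • f s‖ ^ 2 * Real.exp (-2 * ν * t))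
      ≤ ENNReal.ofReal
        (((1 / ν) * C) ^ 2 * ∫ t : ℝ, ‖f t‖ ^ 2 * Real.exp (-2 * ν * t)) := by
    refine le_trans (lintegral_mono fun t => ?_) hbound
    rw [← enorm_sq_mul_ofReal_exp]
    gcongr
    exact enorm_integral_le_lintegral_enorm _
  have hint : Integrable
      (fun t : ℝ => ‖∫ s, G (t - s) • f s‖ ^ 2 * Real.exp (-2 * ν * t)) := by
    refine ⟨(hprod.integral_prod_right'.norm.pow 2).mul
      (by fun_prop : Continuous fun t => Real.exp (-2 * ν * t)).aestronglyMeasurable, ?_⟩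
    rw [hasFiniteIntegral_iff_ofReal (.of_forall fun t => by positivity)]
    exact hconv.trans_lt ENNReal.ofReal_lt_top
  refine ⟨?_, hint, ?_⟩
  · have hmeas : AEMeasurable fun t => ((∫⁻ s, ‖G (t - s) • f s‖ₑ) * e t) ^ 2 :=
      (hprod.enorm.lintegral_prod_right'.mul he_meas.aemeasurable).pow_const 2
    filter_upwards [ae_lt_top' hmeas (hbound.trans_lt ENNReal.ofReal_lt_top).ne,
      hprod.prodMk_left] with t ht ht_meas
    refine ⟨ht_meas, lt_top_iff_ne_top.2 fun htop => ht.ne ?_⟩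
    have he0 : e t ≠ 0 := by simp [he, Real.exp_pos]
    rw [htop, ENNReal.top_mul he0]
    simp
  · rw [← ENNReal.ofReal_le_ofReal_iff (by positivity),
      ofReal_integral_eq_lintegral_ofReal hint (.of_forall fun t => by positivity)]
    exact hconv

theorem stmt_13 {H : Type*}
    [NormedAddCommGroup H] [InnerProductSpace ℂ H] [CompleteSpace H]
    (ν : ℝ) (hν : 0 < ν)
    (h : ℝ → ℂ) (hh : IntegrableOn h (Set.Ici 0))
    (g₀ : ℂ) (g : ℝ → ℂ)
    (hg : ∀ t : ℝ, g t = g₀ + ∫ s in (0 : ℝ)..t, h s)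
    (f : ℝ → H)
    (hf_meas : AEStronglyMeasurable f (volume : Measure ℝ))
    (hf : Integrable (fun t : ℝ => ‖f t‖ ^ 2 * Real.exp (-2 * ν * t))) :
    -- `(g ∗ f)(t)` is well defined for almost every `t` ...
    (∀ᵐ t : ℝ, IntegrableOn (fun s : ℝ => g (t - s) • f s) (Set.Iic t)) ∧
    -- ... belongs to `H_{ν,0}(ℝ; H)` ...
    Integrable (fun t : ℝ =>
      ‖∫ s in Set.Iic t, g (t - s) • f s‖ ^ 2 * Real.exp (-2 * ν * t)) ∧
    -- ... and `‖g ∗ f‖_{ν,0} ≤ ν⁻¹(‖h‖_{L¹(ℝ_{≥0})} + |g₀|)‖f‖_{ν,0}` (squared form):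
    (∫ t : ℝ, ‖∫ s in Set.Iic t, g (t - s) • f s‖ ^ 2 * Real.exp (-2 * ν * t))
      ≤ ((1 / ν) * ((∫ s in Set.Ici (0 : ℝ), ‖h s‖) + ‖g₀‖)) ^ 2
        * ∫ t : ℝ, ‖f t‖ ^ 2 * Real.exp (-2 * ν * t) := by
  set G : ℝ → ℂ := (Set.Ici 0).indicator g with hG
  have hG_meas : Measurable G := by
    have hcont : Continuous fun t : ℝ => g₀ + ∫ s in (0 : ℝ)..t, (Set.Ici 0).indicator h s :=
      continuous_const.add
        (((integrable_indicator_iff measurableSet_Ici).2 hh).continuous_primitive 0)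
    have : G = (Set.Ici 0).indicator
        fun t : ℝ => g₀ + ∫ s in (0 : ℝ)..t, (Set.Ici 0).indicator h s := by
      refine Set.indicator_congr fun t ht => ?_
      rw [hg t]
      congr 1
      refine intervalIntegral.integral_congr fun s hs => ?_
      rw [Set.uIcc_of_le ht] at hs
      exact (Set.indicator_of_mem (show s ∈ Set.Ici 0 from hs.1) h).symm
    rw [this]
    exact hcont.measurable.indicator measurableSet_Ici
  have hC : 0 ≤ (∫ s in Set.Ici (0 : ℝ), ‖h s‖) + ‖g₀‖ := by positivity
  have hG_le (u : ℝ) : ‖G u‖ ≤ (∫ s in Set.Ici (0 : ℝ), ‖h s‖) + ‖g₀‖ := by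
    by_cases hu : u ∈ Set.Ici 0
    · rw [hG, Set.indicator_of_mem hu, hg, add_comm, intervalIntegral.integral_of_le hu]
      refine (norm_add_le _ _).trans ?_
      gcongr
      refine (norm_integral_le_integral_norm _).trans ?_
      exact setIntegral_mono_set hh.norm (.of_forall fun s => norm_nonneg _)
        (Set.Ioc_subset_Ioi_self.trans Set.Ioi_subset_Ici_self).eventuallyLE
    · rwa [hG, Set.indicator_of_notMem hu, norm_zero]
  have hG_smul (t : ℝ) : (fun s => G (t - s) • f s)
      = (Set.Iic t).indicator fun s => g (t - s) • f s := by
    ext s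
    by_cases hs : s ≤ t <;> simp [hG, Set.indicator, hs]
  have key := weighted_convolution_bound hν hG_meas hC
    (fun u hu => Set.indicator_of_notMem (by simpa using hu) g) hG_le hf_meas hf
  simpa only [hG_smul, integrable_indicator_iff measurableSet_Iic,
    integral_indicator measurableSet_Iic] using key
end

section
/- Let H be a complex Hilbert space, let M ∈ L(H) be selfadjoint and boundedly invertible with ⟨M⁻¹ x, x⟩ ≥ c₂ ‖x‖² for all x ∈ H and some c₂ > 0. Let T ∈ L(H) with ‖T‖ ≤ b for some b ≥ 0, and let z ∈ ℂ \ {0} with ν := Re(z⁻¹) > 0 and ν⁻¹ ‖M⁻¹‖ b < 1. Then M − zT is boundedly invertible in L(H), and for all x ∈ H, Re⟨z⁻¹ (M − zT)⁻¹ x, x⟩ ≥ (ν c₂ − ‖M⁻¹‖² b / (1 − ν⁻¹ ‖M⁻¹‖ b)) ‖x‖². -/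
open scoped InnerProductSpace

theorem im_inner_rightInverse_apply_self {H : Type*} [NormedAddCommGroup H]
    [InnerProductSpace ℂ H] [CompleteSpace H] {M N : H →L[ℂ] H} (hM : IsSelfAdjoint M)
    (hMN : M * N = 1) (x : H) : (⟪N x, x⟫_ℂ).im = 0 := by
  have hx : M (N x) = x := DFunLike.congr_fun hMN x
  have hsymm : ⟪M (N x), N x⟫_ℂ = ⟪N x, M (N x)⟫_ℂ := hM.isSymmetric (N x) (N x)
  rw [hx] at hsymm
  have him := inner_im_symm (𝕜 := ℂ) x (N x)
  rw [hsymm] at him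
  simp only [RCLike.im_to_complex] at him
  linarith

theorem stmt_15 {H : Type*}
    [NormedAddCommGroup H] [InnerProductSpace ℂ H] [CompleteSpace H]
    (M Minv T : H →L[ℂ] H)
    (hMsa : IsSelfAdjoint M)
    (hMinv₁ : Minv.comp M = ContinuousLinearMap.id ℂ H)
    (hMinv₂ : M.comp Minv = ContinuousLinearMap.id ℂ H)
    (c₂ : ℝ) (hc₂ : 0 < c₂)
    (hcoerc : ∀ x : H, c₂ * ‖x‖ ^ 2 ≤ (⟪Minv x, x⟫_ℂ).re)
    (b : ℝ) (hb : 0 ≤ b) (hT : ‖T‖ ≤ b)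
    (z : ℂ) (hz : z ≠ 0)
    (ν : ℝ) (hν : ν = (z⁻¹).re) (hνpos : 0 < ν)
    (hsmall : ν⁻¹ * ‖Minv‖ * b < 1) :
    ∃ S : H →L[ℂ] H, (M - z • T) * S = 1 ∧ S * (M - z • T) = 1 ∧
      ∀ x : H,
        (ν * c₂ - ‖Minv‖ ^ 2 * b / (1 - ν⁻¹ * ‖Minv‖ * b)) * ‖x‖ ^ 2
          ≤ (⟪z⁻¹ • S x, x⟫_ℂ).re := by
  have hl : Minv * M = 1 := hMinv₁
  have hr : M * Minv = 1 := hMinv₂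
  have hzν : ‖z‖ ≤ ν⁻¹ := by
    have h := Complex.re_le_norm z⁻¹
    rw [← hν, norm_inv] at h
    exact (le_inv_comm₀ hνpos (norm_pos_iff.mpr hz)).mp h
  set q := ν⁻¹ * ‖Minv‖ * b with hq
  have hK : ‖z • (Minv * T)‖ ≤ q := by
    rw [norm_smul, hq, mul_assoc]
    gcongr
    exact (norm_mul_le _ _).trans (by gcongr)
  let u := Units.oneSub (z • (Minv * T)) (hK.trans_lt hsmall)
  have hu : (u : H →L[ℂ] H) = 1 - z • (Minv * T) := rfl
  have hfac : M - z • T = M * u := by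
    rw [hu, mul_sub, mul_one, mul_smul_comm, ← mul_assoc, hr, one_mul]
  set S : H →L[ℂ] H := ↑u⁻¹ * Minv with hS
  have huS : (u : H →L[ℂ] H) * S = Minv := by rw [hS, Units.mul_inv_cancel_left]
  refine ⟨S, by rw [hfac, mul_assoc, huS, hr], ?_, fun x => ?_⟩
  · rw [hfac, hS, mul_assoc, ← mul_assoc Minv, hl, one_mul, Units.inv_mul]
  have hSx : S x = Minv x + z • Minv (T (S x)) := by
    have h : S x - z • Minv (T (S x)) = Minv x := DFunLike.congr_fun huS x
    rw [← h, sub_add_cancel]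
  have hq1 : 0 < 1 - q := sub_pos.mpr hsmall
  have hbound : ‖S x‖ ≤ ‖Minv‖ * ‖x‖ / (1 - q) := by
    rw [le_div_iff₀ hq1]
    have h₁ : ‖S x‖ ≤ ‖Minv x‖ + ‖z • Minv (T (S x))‖ := by
      conv_lhs => rw [hSx]
      exact norm_add_le _ _
    have h₂ : ‖z • Minv (T (S x))‖ ≤ q * ‖S x‖ :=
      (z • (Minv * T)).le_of_opNorm_le hK (S x)
    linarith [Minv.le_opNorm x]
  have hzS : z⁻¹ • S x = z⁻¹ • Minv x + Minv (T (S x)) := by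
    conv_lhs => rw [hSx]
    rw [smul_add, inv_smul_smul₀ hz]
  have hmain : (⟪z⁻¹ • Minv x, x⟫_ℂ).re = ν * (⟪Minv x, x⟫_ℂ).re := by
    rw [inner_smul_left, Complex.mul_re, im_inner_rightInverse_apply_self hMsa hr, mul_zero,
      sub_zero, Complex.conj_re, hν]
  have hpert : ‖⟪Minv (T (S x)), x⟫_ℂ‖ ≤ ‖Minv‖ ^ 2 * b / (1 - q) * ‖x‖ ^ 2 :=
    calc ‖⟪Minv (T (S x)), x⟫_ℂ‖ ≤ ‖Minv (T (S x))‖ * ‖x‖ := norm_inner_le_norm _ _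
      _ ≤ ‖Minv‖ * (b * (‖Minv‖ * ‖x‖ / (1 - q))) * ‖x‖ := by
        gcongr
        exact Minv.le_opNorm_of_le (T.le_of_opNorm_le_of_le hT hbound)
      _ = ‖Minv‖ ^ 2 * b / (1 - q) * ‖x‖ ^ 2 := by ring
  rw [hzS, inner_add_left, Complex.add_re, hmain, sub_mul, mul_assoc ν]
  have hre := (abs_le.mp (Complex.abs_re_le_norm ⟪Minv (T (S x)), x⟫_ℂ)).1
  linarith [mul_le_mul_of_nonneg_left (hcoerc x) hνpos.le]
end
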